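/- arXiv:2109.08797 — 3 statements merged into one kernel-verified Lean document; each statement's English description precedes it below -/
import Mathlib

section
/- Let ω ∈ ℝ, let F : ℝ → ℝ be continuously differentiable, and let ψ₀ : ℝ³ → ℝ be infinitely differentiable whose spherical-coordinate representation Ψ₀ satisfies (ΔΨ₀)(φ,θ) = F(Ψ₀(φ,θ)) − (1/(4π)) ∫₀^{2π} ∫_{−π/2}^{π/2} F(Ψ₀(φ',θ')) cos θ' dθ' dφ' for all φ ∈ ℝ and θ ∈ (−π/2, π/2). Then Ψ(t,φ,θ) := ω sin θ + Ψ₀(φ + ω t, θ) is a solution of the vorticity equation (E_ω). -/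
open Real MeasureTheory

noncomputable section

/-- The point of the unit sphere with longitude `φ` and latitude `θ`. -/
def sphPt (φ θ : ℝ) : ℝ × ℝ × ℝ :=
  (Real.cos φ * Real.cos θ, Real.sin φ * Real.cos θ, Real.sin θ)

/-- The spherical-coordinate representation of a function `ψ : ℝ³ → ℝ`. -/
def sphRep (ψ : ℝ × ℝ × ℝ → ℝ) (φ θ : ℝ) : ℝ := ψ (sphPt φ θ)

/-- The Laplace–Beltrami operator of the unit sphere in longitude-latitude coordinates:
`(ΔΨ)(φ,θ) = ∂θ²Ψ − tan θ · ∂θΨ + (1/cos²θ) · ∂φ²Ψ`. -/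
def LB (Ψ : ℝ → ℝ → ℝ) (φ θ : ℝ) : ℝ :=
  iteratedDeriv 2 (fun θ' => Ψ φ θ') θ
    - Real.tan θ * deriv (fun θ' => Ψ φ θ') θ
    + (1 / Real.cos θ ^ 2) * iteratedDeriv 2 (fun φ' => Ψ φ' θ) φ

/-- The vorticity (Euler) equation `(E_ω)` on the sphere rotating at speed `ω`, for a
time-dependent stream function with representation `Ψ t φ θ`:
`∂t(ΔΨ) + (1/cos θ)·[∂φΨ · ∂θ(ΔΨ + 2ω sin θ) − ∂θΨ · ∂φ(ΔΨ + 2ω sin θ)] = 0`. -/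
def EulerEq (ω : ℝ) (Ψ : ℝ → ℝ → ℝ → ℝ) : Prop :=
  ∀ t φ θ : ℝ, θ ∈ Set.Ioo (-(π/2)) (π/2) →
    deriv (fun t' => LB (Ψ t') φ θ) t
      + (1 / Real.cos θ) *
        (deriv (fun φ' => Ψ t φ' θ) φ *
            deriv (fun θ' => LB (Ψ t) φ θ' + 2 * ω * Real.sin θ') θ
          - deriv (fun θ' => Ψ t φ θ') θ *
            deriv (fun φ' => LB (Ψ t) φ' θ + 2 * ω * Real.sin θ) φ) = 0

theorem contDiff_sphPt {n : WithTop ℕ∞} :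
    ContDiff ℝ n (fun p : ℝ × ℝ => sphPt p.1 p.2) := by
  unfold sphPt
  fun_prop

theorem ContDiff.sphRep_longitude {n : WithTop ℕ∞} {ψ : ℝ × ℝ × ℝ → ℝ} (hψ : ContDiff ℝ n ψ)
    (θ : ℝ) : ContDiff ℝ n (fun φ => sphRep ψ φ θ) :=
  hψ.comp (contDiff_sphPt.comp (contDiff_id.prodMk contDiff_const))

theorem ContDiff.sphRep_latitude {n : WithTop ℕ∞} {ψ : ℝ × ℝ × ℝ → ℝ} (hψ : ContDiff ℝ n ψ)
    (φ : ℝ) : ContDiff ℝ n (fun θ => sphRep ψ φ θ) :=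
  hψ.comp (contDiff_sphPt.comp (contDiff_const.prodMk contDiff_id))

/-- The Laplace–Beltrami operator commutes with rotations about the axis, and `sin θ` is an
eigenfunction of it with eigenvalue `-2`. -/
theorem LB_const_mul_sin_add_rotation {Ψ : ℝ → ℝ → ℝ} (a c φ : ℝ) {θ : ℝ}
    (hΨ : ContDiff ℝ 2 (Ψ (φ + c))) (hθ : Real.cos θ ≠ 0) :
    LB (fun φ θ => a * Real.sin θ + Ψ (φ + c) θ) φ θ
      = LB Ψ (φ + c) θ - 2 * a * Real.sin θ := by
  have hsin : ContDiff ℝ 2 (fun θ => a * Real.sin θ) := by fun_prop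
  have hderiv : deriv (fun θ => a * Real.sin θ) = fun θ => a * Real.cos θ := by
    ext x
    exact ((Real.hasDerivAt_sin x).const_mul a).deriv
  have hsin₂ : iteratedDeriv 2 (fun θ => a * Real.sin θ) θ = -(a * Real.sin θ) := by
    rw [iteratedDeriv_succ, iteratedDeriv_one, hderiv,
      ((Real.hasDerivAt_cos θ).const_mul a).deriv]
    ring
  have hlat : deriv (fun θ' => a * Real.sin θ' + Ψ (φ + c) θ') θ
      = a * Real.cos θ + deriv (fun θ' => Ψ (φ + c) θ') θ :=
    (((Real.hasDerivAt_sin θ).const_mul a).add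
      ((hΨ.differentiable two_ne_zero).differentiableAt.hasDerivAt)).deriv
  have hlat₂ : iteratedDeriv 2 (fun θ' => a * Real.sin θ' + Ψ (φ + c) θ') θ
      = -(a * Real.sin θ) + iteratedDeriv 2 (fun θ' => Ψ (φ + c) θ') θ := by
    rw [← hsin₂]
    exact iteratedDeriv_fun_add hsin.contDiffAt hΨ.contDiffAt
  have hlon : iteratedDeriv 2 (fun φ' => a * Real.sin θ + Ψ (φ' + c) θ) φ
      = iteratedDeriv 2 (fun φ' => Ψ φ' θ) (φ + c) := by
    rw [iteratedDeriv_const_add two_pos, iteratedDeriv_comp_add_const 2 (fun φ' => Ψ φ' θ) c]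
  have htan : Real.tan θ * Real.cos θ = Real.sin θ := Real.tan_mul_cos hθ
  unfold LB
  rw [hlat, hlat₂, hlon]
  linear_combination (-a) * htan

/-- If `Ψ₀` solves `ΔΨ₀ = F(Ψ₀) − (1/4π)∫_{S²} F(Ψ₀) dσ`, then
`Ψ(t,φ,θ) = ω sin θ + Ψ₀(φ + ωt, θ)` is a solution of the vorticity equation `(E_ω)`. -/
theorem geostationary_solution (ω : ℝ) (F : ℝ → ℝ) (hF : ContDiff ℝ 1 F)
    (ψ₀ : ℝ × ℝ × ℝ → ℝ) (hψ₀ : ContDiff ℝ (⊤ : ℕ∞) ψ₀)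
    (heq : ∀ φ θ : ℝ, θ ∈ Set.Ioo (-(π/2)) (π/2) →
      LB (sphRep ψ₀) φ θ = F (sphRep ψ₀ φ θ)
        - (1/(4*π)) * ∫ φ' in (0:ℝ)..(2*π), ∫ θ' in (-(π/2))..(π/2),
            F (sphRep ψ₀ φ' θ') * Real.cos θ') :
    EulerEq ω (fun t φ θ => ω * Real.sin θ + sphRep ψ₀ (φ + ω * t) θ) := by
  intro t φ θ hθ
  have hcos : ∀ θ ∈ Set.Ioo (-(π/2)) (π/2), Real.cos θ ≠ 0 :=
    fun θ hθ => (Real.cos_pos_of_mem_Ioo hθ).ne'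
  generalize (1/(4*π)) * ∫ φ' in (0:ℝ)..(2*π), ∫ θ' in (-(π/2))..(π/2),
    F (sphRep ψ₀ φ' θ') * Real.cos θ' = C at heq
  have hLB : ∀ t φ, ∀ θ ∈ Set.Ioo (-(π/2)) (π/2),
      LB (fun φ θ => ω * Real.sin θ + sphRep ψ₀ (φ + ω * t) θ) φ θ
        = F (sphRep ψ₀ (φ + ω * t) θ) - C - 2 * ω * Real.sin θ := fun t φ θ hθ => by
    rw [LB_const_mul_sin_add_rotation ω (ω * t) φ
      ((contDiff_infty.1 hψ₀ 2).sphRep_latitude _) (hcos θ hθ), heq _ θ hθ]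
  set Y := sphRep ψ₀ (φ + ω * t) θ
  have hF' : HasDerivAt F (deriv F Y) Y :=
    (hF.differentiable one_ne_zero).differentiableAt.hasDerivAt
  obtain ⟨p, hp⟩ : ∃ p, HasDerivAt (fun φ => sphRep ψ₀ φ θ) p (φ + ω * t) :=
    ⟨_, ((hψ₀.sphRep_longitude θ).differentiable (by simp)).differentiableAt.hasDerivAt⟩
  obtain ⟨q, hq⟩ : ∃ q, HasDerivAt (fun θ => sphRep ψ₀ (φ + ω * t) θ) q θ :=
    ⟨_, ((hψ₀.sphRep_latitude _).differentiable (by simp)).differentiableAt.hasDerivAt⟩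
  have hpφ : HasDerivAt (fun φ => sphRep ψ₀ (φ + ω * t) θ) p φ := hp.comp_add_const φ (ω * t)
  have hpt : HasDerivAt (fun t => sphRep ψ₀ (φ + ω * t) θ) (p * ω) t := by
    have hlin : HasDerivAt (fun t => φ + ω * t) ω t := by
      simpa using ((hasDerivAt_id t).const_mul ω).const_add φ
    exact hp.comp t hlin
  have hvort_t : deriv (fun t => LB (fun φ θ => ω * Real.sin θ + sphRep ψ₀ (φ + ω * t) θ) φ θ) t
      = deriv F Y * (p * ω) := by
    simp only [hLB _ _ θ hθ]
    exact (((hF'.comp t hpt).sub_const C).sub_const _).deriv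
  have hvort_φ : deriv (fun φ => LB (fun φ θ => ω * Real.sin θ + sphRep ψ₀ (φ + ω * t) θ) φ θ
      + 2 * ω * Real.sin θ) φ = deriv F Y * p := by
    simp only [hLB _ _ θ hθ, sub_add_cancel]
    exact ((hF'.comp φ hpφ).sub_const C).deriv
  have hvort_θ : deriv (fun θ => LB (fun φ θ => ω * Real.sin θ + sphRep ψ₀ (φ + ω * t) θ) φ θ
      + 2 * ω * Real.sin θ) θ = deriv F Y * q := by
    refine (((hF'.comp θ hq).sub_const C).congr_of_eventuallyEq ?_).deriv
    filter_upwards [isOpen_Ioo.mem_nhds hθ] with x hx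
    simp [hLB t φ x hx]
  have hstream_φ : deriv (fun φ => ω * Real.sin θ + sphRep ψ₀ (φ + ω * t) θ) φ = p :=
    (hpφ.const_add _).deriv
  have hstream_θ : deriv (fun θ => ω * Real.sin θ + sphRep ψ₀ (φ + ω * t) θ) θ
      = ω * Real.cos θ + q :=
    (((Real.hasDerivAt_sin θ).const_mul ω).add hq).deriv
  rw [hvort_t, hvort_φ, hvort_θ, hstream_φ, hstream_θ]
  have := hcos θ hθ
  field_simp
  ring
end
end

section
/- Let ω, g ∈ ℝ, let ρ₀ : ℝ → (0,∞) be continuously differentiable (the vertical density stratification), let F : ℝ → ℝ be continuous with primitive 𝓕, and let ψ₀ : ℝ³ → ℝ be infinitely differentiable whose spherical-coordinate representation Ψ₀ satisfies (ΔΨ₀)(φ,θ) = F(Ψ₀(φ,θ)) for all φ ∈ ℝ and θ ∈ (−π/2, π/2). Define, for t, z ∈ ℝ, φ ∈ ℝ, θ ∈ (−π/2, π/2): the stream function ψ(t,φ,θ,z) = ω sin θ + ρ₀(z)^{−1/2}·Ψ₀(φ + ω t, θ); the velocities u₀ = −∂θψ, v₀ = (1/cos θ)·∂φψ; and the pressure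 p₀(t,φ,θ,z) = 𝓕(Ψ₀(φ+ωt,θ)) − (1/2)(∂θΨ₀(φ+ωt,θ))² − (1/(2cos²θ))(∂φΨ₀(φ+ωt,θ))² − g·∫₀^z ρ₀(s) ds. Then the leading-order stratospheric flow equations hold: (a) ∂t u₀ + (u₀/cos θ)∂φu₀ + v₀∂θu₀ − u₀v₀ tan θ − 2ω v₀ sin θ = −(1/(ρ₀(z) cos θ))∂φp₀; (b) ∂t v₀ + (u₀/cos θ)∂φv₀ + v₀∂θv₀ + u₀² tan θ + 2ω u₀ sin θ + ω² sin θ cos θ = −(1/ρ₀(z))∂θp₀; (c) ∂z p₀ = −g ρ₀(z); (d) ∂φu₀ + ∂θ(v₀ cos θ) = 0. -/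
open Real MeasureTheory

noncomputable section

/-- A smooth function of two real variables has iterated partial derivatives up to order two,
and the mixed ones agree. -/
theorem exists_partialDerivs_of_contDiff {f : ℝ → ℝ → ℝ}
    (hf : ContDiff ℝ 2 (fun p : ℝ × ℝ => f p.1 p.2)) :
    ∃ fx fy fxx fxy fyy : ℝ → ℝ → ℝ, ∀ x y : ℝ,
      HasDerivAt (fun x' => f x' y) (fx x y) x ∧ HasDerivAt (fun y' => f x y') (fy x y) y ∧
      HasDerivAt (fun x' => fx x' y) (fxx x y) x ∧ HasDerivAt (fun y' => fx x y') (fxy x y) y ∧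
      HasDerivAt (fun x' => fy x' y) (fxy x y) x ∧ HasDerivAt (fun y' => fy x y') (fyy x y) y := by
  set G : ℝ × ℝ → ℝ := fun p => f p.1 p.2
  have hcurve₁ (x y : ℝ) : HasDerivAt (fun x' : ℝ => (x', y)) ((1 : ℝ), (0 : ℝ)) x :=
    (hasDerivAt_id x).prodMk (hasDerivAt_const x y)
  have hcurve₂ (x y : ℝ) : HasDerivAt (fun y' : ℝ => (x, y')) ((0 : ℝ), (1 : ℝ)) y :=
    (hasDerivAt_const y x).prodMk (hasDerivAt_id y)
  have hG (p : ℝ × ℝ) : HasFDerivAt G (fderiv ℝ G p) p :=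
    (hf.differentiable (by norm_num) p).hasFDerivAt
  have hG' (v p : ℝ × ℝ) : HasFDerivAt (fun q => fderiv ℝ G q v)
      ((fderiv ℝ (fderiv ℝ G) p).flip v) p := by
    have h : ContDiff ℝ 1 (fderiv ℝ G) := hf.fderiv_right (by norm_num)
    simpa using! (h.differentiable (by norm_num) p).hasFDerivAt.clm_apply
      (hasFDerivAt_const v p)
  have hsymm (p v w : ℝ × ℝ) :
      fderiv ℝ (fderiv ℝ G) p v w = fderiv ℝ (fderiv ℝ G) p w v :=
    (hf.contDiffAt.isSymmSndFDerivAt (by simp)) v w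
  refine ⟨fun x y => fderiv ℝ G (x, y) (1, 0), fun x y => fderiv ℝ G (x, y) (0, 1),
    fun x y => fderiv ℝ (fderiv ℝ G) (x, y) (1, 0) (1, 0),
    fun x y => fderiv ℝ (fderiv ℝ G) (x, y) (0, 1) (1, 0),
    fun x y => fderiv ℝ (fderiv ℝ G) (x, y) (0, 1) (0, 1), fun x y => ⟨?_, ?_, ?_, ?_, ?_, ?_⟩⟩
  · exact (hG (x, y)).comp_hasDerivAt x (hcurve₁ x y)
  · exact (hG (x, y)).comp_hasDerivAt y (hcurve₂ x y)
  · exact (hG' (1, 0) (x, y)).comp_hasDerivAt x (hcurve₁ x y)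
  · exact (hG' (1, 0) (x, y)).comp_hasDerivAt y (hcurve₂ x y)
  · beta_reduce
    rw [hsymm]
    exact (hG' (0, 1) (x, y)).comp_hasDerivAt x (hcurve₁ x y)
  · exact (hG' (0, 1) (x, y)).comp_hasDerivAt y (hcurve₂ x y)

theorem contDiff_sphRep {n : WithTop ℕ∞} {ψ : ℝ × ℝ × ℝ → ℝ} (hψ : ContDiff ℝ n ψ) :
    ContDiff ℝ n (fun p : ℝ × ℝ => sphRep ψ p.1 p.2) := by
  unfold sphRep sphPt
  fun_prop

/-- Embedding of 2D stationary Euler flows into the leading-order 3D stratospheric dynamics: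
if `ΔΨ₀ = F(Ψ₀)` on the sphere, then the stream function
`ψ(t,φ,θ,z) = ω sin θ + ρ₀(z)^{−1/2} Ψ₀(φ+ωt, θ)`, with the associated velocities
`u₀ = −∂θψ`, `v₀ = (1/cos θ)∂φψ` and the pressure `p₀`, solves the leading-order
stratospheric flow equations (a)–(d). -/
theorem stratospheric_flow (ω g : ℝ) (ρ₀ : ℝ → ℝ)
    (hρpos : ∀ z : ℝ, 0 < ρ₀ z) (hρ : ContDiff ℝ 1 ρ₀)
    (F 𝓕 : ℝ → ℝ) (hF : Continuous F) (hprim : ∀ s : ℝ, HasDerivAt 𝓕 (F s) s)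
    (ψ₀ : ℝ × ℝ × ℝ → ℝ) (hψ₀ : ContDiff ℝ (⊤ : ℕ∞) ψ₀)
    (heq : ∀ φ θ : ℝ, θ ∈ Set.Ioo (-(π/2)) (π/2) →
      LB (sphRep ψ₀) φ θ = F (sphRep ψ₀ φ θ))
    (ψ u₀ v₀ p₀ : ℝ → ℝ → ℝ → ℝ → ℝ)
    (hψdef : ∀ t φ θ z : ℝ, ψ t φ θ z
      = ω * Real.sin θ + (Real.sqrt (ρ₀ z))⁻¹ * sphRep ψ₀ (φ + ω * t) θ)
    (hu : ∀ t φ θ z : ℝ, u₀ t φ θ z = - deriv (fun θ' => ψ t φ θ' z) θ)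
    (hv : ∀ t φ θ z : ℝ, v₀ t φ θ z = (1 / Real.cos θ) * deriv (fun φ' => ψ t φ' θ z) φ)
    (hp : ∀ t φ θ z : ℝ, p₀ t φ θ z
      = 𝓕 (sphRep ψ₀ (φ + ω * t) θ)
        - (1/2) * (deriv (fun θ' => sphRep ψ₀ (φ + ω * t) θ') θ) ^ 2
        - (1/(2 * Real.cos θ ^ 2)) * (deriv (fun φ' => sphRep ψ₀ φ' θ) (φ + ω * t)) ^ 2
        - g * ∫ s in (0:ℝ)..z, ρ₀ s) :
    ∀ t φ θ z : ℝ, θ ∈ Set.Ioo (-(π/2)) (π/2) →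
      (deriv (fun t' => u₀ t' φ θ z) t
          + (u₀ t φ θ z / Real.cos θ) * deriv (fun φ' => u₀ t φ' θ z) φ
          + v₀ t φ θ z * deriv (fun θ' => u₀ t φ θ' z) θ
          - u₀ t φ θ z * v₀ t φ θ z * Real.tan θ
          - 2 * ω * v₀ t φ θ z * Real.sin θ
        = -(1/(ρ₀ z * Real.cos θ)) * deriv (fun φ' => p₀ t φ' θ z) φ)
      ∧ (deriv (fun t' => v₀ t' φ θ z) t
          + (u₀ t φ θ z / Real.cos θ) * deriv (fun φ' => v₀ t φ' θ z) φ
          + v₀ t φ θ z * deriv (fun θ' => v₀ t φ θ' z) θ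
          + (u₀ t φ θ z) ^ 2 * Real.tan θ
          + 2 * ω * u₀ t φ θ z * Real.sin θ
          + ω ^ 2 * Real.sin θ * Real.cos θ
        = -(1/(ρ₀ z)) * deriv (fun θ' => p₀ t φ θ' z) θ)
      ∧ (deriv (fun z' => p₀ t φ θ z') z = -(g * ρ₀ z))
      ∧ (deriv (fun φ' => u₀ t φ' θ z) φ
          + deriv (fun θ' => v₀ t φ θ' z * Real.cos θ') θ = 0) := by
  intro t φ θ z hθ
  have hcos : Real.cos θ ≠ 0 := (Real.cos_pos_of_mem_Ioo hθ).ne'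
  obtain ⟨A, B, Aφ, C, Bθ, hΨ⟩ := exists_partialDerivs_of_contDiff
    (contDiff_sphRep (hψ₀.of_le (WithTop.coe_le_coe.2 (le_top : (2 : ℕ∞) ≤ ⊤))))
  have hA (x y : ℝ) := (hΨ x y).1
  have hB (x y : ℝ) := (hΨ x y).2.1
  have hAφ (x y : ℝ) := (hΨ x y).2.2.1
  have hAθ (x y : ℝ) := (hΨ x y).2.2.2.1
  have hBφ (x y : ℝ) := (hΨ x y).2.2.2.2.1
  have hBθ (x y : ℝ) := (hΨ x y).2.2.2.2.2
  have hiter (f : ℝ → ℝ) : iteratedDeriv 2 f = deriv (deriv f) := by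
    rw [iteratedDeriv_succ, iteratedDeriv_one]
  have hPDE : F (sphRep ψ₀ (φ + ω * t) θ) = Bθ (φ + ω * t) θ
      - Real.tan θ * B (φ + ω * t) θ + 1 / Real.cos θ ^ 2 * Aφ (φ + ω * t) θ := by
    rw [← heq _ _ hθ, LB, hiter, hiter, (hB _ _).deriv,
      funext fun y => (hB (φ + ω * t) y).deriv,
      funext fun x => (hA x θ).deriv, (hBθ _ _).deriv, (hAφ _ _).deriv]
  have shift {f : ℝ → ℝ} {f' : ℝ} (φ t : ℝ) (hf : HasDerivAt f f' (φ + ω * t)) :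
      HasDerivAt (fun x => f (x + ω * t)) f' φ := hf.comp_add_const φ (ω * t)
  have shift_time {f : ℝ → ℝ} {f' : ℝ} (hf : HasDerivAt f f' (φ + ω * t)) :
      HasDerivAt (fun τ => f (φ + ω * τ)) (f' * ω) t := by
    have h : HasDerivAt (fun τ => φ + ω * τ) ω t := by
      simpa using ((hasDerivAt_id t).const_mul ω).const_add φ
    exact hf.comp t h
  have hu' (t φ θ z : ℝ) : u₀ t φ θ z
      = -(ω * Real.cos θ + (Real.sqrt (ρ₀ z))⁻¹ * B (φ + ω * t) θ) := by
    simp only [hu, hψdef]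
    rw [(((Real.hasDerivAt_sin θ).const_mul ω).fun_add ((hB _ θ).const_mul _)).deriv]
  have hv' (t φ θ z : ℝ) : v₀ t φ θ z
      = (Real.cos θ)⁻¹ * ((Real.sqrt (ρ₀ z))⁻¹ * A (φ + ω * t) θ) := by
    simp only [hv, hψdef]
    rw [(((shift φ t (hA _ θ)).const_mul _).const_add _).deriv, one_div]
  have hp' (t φ θ z : ℝ) : p₀ t φ θ z = 𝓕 (sphRep ψ₀ (φ + ω * t) θ)
      - (1/2) * B (φ + ω * t) θ ^ 2
      - (1/2) * ((Real.cos θ)⁻¹ * A (φ + ω * t) θ) ^ 2 - g * ∫ s in (0:ℝ)..z, ρ₀ s := by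
    rw [hp, (hA _ _).deriv, (hB _ _).deriv]
    ring
  set σ := (Real.sqrt (ρ₀ z))⁻¹ with hσ
  have hρσ : (ρ₀ z)⁻¹ = σ ^ 2 := by rw [hσ, inv_pow, Real.sq_sqrt (hρpos z).le]
  have hcosinv : HasDerivAt (fun y => (Real.cos y)⁻¹) (Real.sin θ / Real.cos θ ^ 2) θ := by
    simpa using (Real.hasDerivAt_cos θ).fun_inv hcos
  have hut : deriv (fun t' => u₀ t' φ θ z) t = -(σ * (C (φ + ω * t) θ * ω)) := by
    simp only [hu']
    exact ((((shift_time (hBφ _ θ)).const_mul _).const_add _).neg).deriv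
  have huφ : deriv (fun φ' => u₀ t φ' θ z) φ = -(σ * C (φ + ω * t) θ) := by
    simp only [hu']
    exact ((((shift φ t (hBφ _ θ)).const_mul _).const_add _).neg).deriv
  have huθ : deriv (fun θ' => u₀ t φ θ' z) θ
      = -(ω * -Real.sin θ + σ * Bθ (φ + ω * t) θ) := by
    simp only [hu']
    exact ((((Real.hasDerivAt_cos θ).const_mul ω).add ((hBθ _ θ).const_mul _)).neg).deriv
  have hvt : deriv (fun t' => v₀ t' φ θ z) t
      = (Real.cos θ)⁻¹ * (σ * (Aφ (φ + ω * t) θ * ω)) := by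
    simp only [hv']
    exact (((shift_time (hAφ _ θ)).const_mul _).const_mul _).deriv
  have hvφ : deriv (fun φ' => v₀ t φ' θ z) φ = (Real.cos θ)⁻¹ * (σ * Aφ (φ + ω * t) θ) := by
    simp only [hv']
    exact (((shift φ t (hAφ _ θ)).const_mul _).const_mul _).deriv
  have hvθ : HasDerivAt (fun θ' => v₀ t φ θ' z)
      (Real.sin θ / Real.cos θ ^ 2 * (σ * A (φ + ω * t) θ)
        + (Real.cos θ)⁻¹ * (σ * C (φ + ω * t) θ)) θ := by
    simp only [hv']
    exact hcosinv.mul ((hAθ _ θ).const_mul _)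
  have hpφ : deriv (fun φ' => p₀ t φ' θ z) φ
      = F (sphRep ψ₀ (φ + ω * t) θ) * A (φ + ω * t) θ - B (φ + ω * t) θ * C (φ + ω * t) θ
        - (Real.cos θ)⁻¹ ^ 2 * A (φ + ω * t) θ * Aφ (φ + ω * t) θ := by
    simp only [hp']
    refine ((((((hprim _).comp φ (shift φ t (hA _ θ))).sub
      (((shift φ t (hBφ _ θ)).pow 2).const_mul _)).sub
      ((((shift φ t (hAφ _ θ)).const_mul _).pow 2).const_mul _)).sub_const _).deriv).trans ?_
    push_cast
    ring
  have hpθ : deriv (fun θ' => p₀ t φ θ' z) θ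
      = F (sphRep ψ₀ (φ + ω * t) θ) * B (φ + ω * t) θ - B (φ + ω * t) θ * Bθ (φ + ω * t) θ
        - (Real.cos θ)⁻¹ * A (φ + ω * t) θ * (Real.sin θ / Real.cos θ ^ 2 * A (φ + ω * t) θ
          + (Real.cos θ)⁻¹ * C (φ + ω * t) θ) := by
    simp only [hp']
    refine ((((((hprim _).comp θ (hB _ θ)).sub
      (((hBθ _ θ).pow 2).const_mul _)).sub
      (((hcosinv.mul (hAθ _ θ)).pow 2).const_mul _)).sub_const _).deriv).trans ?_
    simp only [Pi.mul_apply]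
    push_cast
    ring
  refine ⟨?_, ?_, ?_, ?_⟩
  · rw [hut, huφ, huθ, hpφ, hu', hv', hPDE, one_div, mul_inv, hρσ, Real.tan_eq_sin_div_cos]
    field_simp
    ring
  · rw [hvt, hvφ, hvθ.deriv, hpθ, hu', hv', hPDE, one_div, hρσ, Real.tan_eq_sin_div_cos]
    field_simp
    ring
  · simp only [hp']
    rw [((intervalIntegral.integral_hasDerivAt_right (hρ.continuous.intervalIntegrable _ _)
      (hρ.continuous.stronglyMeasurableAtFilter _ _)
      hρ.continuous.continuousAt).const_mul g |>.const_sub _).deriv]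
  · rw [huφ, (hvθ.fun_mul (Real.hasDerivAt_cos θ)).deriv, hv']
    field_simp
    ring
end
end

section
/- (Instability of non-zonal Rossby–Haurwitz waves.) Let ω, α ∈ ℝ, β ≠ 0, let j ≥ 2 be an integer, and let Y : ℝ³ → ℝ be infinitely differentiable, non-zonal (there exist φ, φ', θ with 𝒴(φ,θ) ≠ 𝒴(φ',θ)), whose spherical-coordinate representation 𝒴 satisfies (Δ𝒴)(φ,θ) = −j(j+1)·𝒴(φ,θ) for all φ ∈ ℝ, θ ∈ (−π/2, π/2). For n ≥ 1 set c = 2ω/(j(j+1)) + α(j(j+1)−2)/(j(j+1)), ĉₙ = 2ω/(j(j+1)) + (α + 1/n)(j(j+1)−2)/(j(j+1)), and define the travelling-wave solutions of (E_ω): Ψ(t,φ,θ) = α sin θ + β 𝒴(φ − c t, θ) and Ψ̂ⁿ(t,φ,θ) = (α + 1/n) sin θ + β 𝒴(φ − ĉₙ t, θ). Then the initial distance ‖Ψ̂ⁿ(0,·) − Ψ(0,·)‖_{L²(dσ)} = (1/n)·√(4π/3) tends to 0 as n → ∞, yet there exists ε > 0, independent of n, such that sup_{t>0} ‖Ψ̂ⁿ(t,·)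 − Ψ(t,·)‖_{L²(dσ)} > ε for every n ≥ 1. -/
open Real MeasureTheory

noncomputable section

/-- The propagation speed of the Rossby–Haurwitz wave of degree `j` with zonal coefficient
`α`: `c = 2ω/(j(j+1)) + α(j(j+1)−2)/(j(j+1))`. -/
def RHspeed (ω α : ℝ) (j : ℕ) : ℝ :=
  2 * ω / ((j : ℝ) * ((j : ℝ) + 1))
    + α * ((j : ℝ) * ((j : ℝ) + 1) - 2) / ((j : ℝ) * ((j : ℝ) + 1))

lemma continuous_sphRep {Y : ℝ × ℝ × ℝ → ℝ} (hY : Continuous Y) :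
    Continuous fun p : ℝ × ℝ => sphRep Y p.1 p.2 := by
  unfold sphRep sphPt
  fun_prop

lemma sphRep_add_two_pi (Y : ℝ × ℝ × ℝ → ℝ) (φ θ : ℝ) :
    sphRep Y (φ + 2 * π) θ = sphRep Y φ θ := by
  simp [sphRep, sphPt]

/-- A function that is not zonal is already not zonal on a parallel distinct from the poles. -/
lemma exists_lat_mem_Ioo_sphRep_ne {Y : ℝ × ℝ × ℝ → ℝ}
    (h : ∃ φ φ' θ : ℝ, sphRep Y φ θ ≠ sphRep Y φ' θ) :
    ∃ φ φ' θ : ℝ, θ ∈ Set.Ioo (-(π/2)) (π/2) ∧ sphRep Y φ θ ≠ sphRep Y φ' θ := by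
  obtain ⟨φ, φ', θ, h⟩ := h
  have hc : Real.cos θ ≠ 0 := by
    intro h0
    simp [sphRep, sphPt, h0] at h
  have hsin : Real.sin (Real.arcsin (Real.sin θ)) = Real.sin θ :=
    Real.sin_arcsin (Real.neg_one_le_sin θ) (Real.sin_le_one θ)
  have hcos : Real.cos (Real.arcsin (Real.sin θ)) = |Real.cos θ| := by
    rw [Real.cos_arcsin, ← Real.abs_cos_eq_sqrt_one_sub_sin_sq]
  have hlt : Real.sin θ ^ 2 < 1 := by
    have := Real.sin_sq_add_cos_sq θ
    have := pow_pos (abs_pos.mpr hc) 2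
    rw [sq_abs] at this
    linarith
  have hmem : Real.arcsin (Real.sin θ) ∈ Set.Ioo (-(π/2)) (π/2) :=
    ⟨Real.neg_pi_div_two_lt_arcsin.mpr (by nlinarith),
      Real.arcsin_lt_pi_div_two.mpr (by nlinarith)⟩
  rcases lt_or_gt_of_ne hc with hneg | hpos
  · refine ⟨φ + π, φ' + π, _, hmem, ?_⟩
    simpa [sphRep, sphPt, hsin, hcos, abs_of_neg hneg] using h
  · refine ⟨φ, φ', _, hmem, ?_⟩
    simpa [sphRep, sphPt, hsin, hcos, abs_of_pos hpos] using h

lemma integral_sin_sq_mul_cos_pi_div_two :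
    ∫ θ in (-(π/2))..(π/2), Real.sin θ ^ 2 * Real.cos θ = 2 / 3 := by
  have h := integral_sin_pow_mul_cos_pow_odd (a := -(π/2)) (b := π/2) 2 0
  simp only [mul_zero, zero_add, pow_one, pow_zero, mul_one] at h
  rw [h, integral_pow]
  norm_num [Real.sin_neg]

lemma continuous_integral_lat {f : ℝ → ℝ → ℝ} (hf : Continuous fun p : ℝ × ℝ => f p.1 p.2) :
    Continuous fun φ => ∫ θ in (-(π/2))..(π/2), f φ θ :=
  intervalIntegral.continuous_parametric_intervalIntegral_of_continuous' hf _ _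

lemma Function.Periodic.intervalIntegral_comp_sub {g : ℝ → ℝ} {T : ℝ}
    (hg : Function.Periodic g T) (s : ℝ) :
    ∫ x in (0:ℝ)..T, g (x - s) = ∫ x in (0:ℝ)..T, g x := by
  rw [intervalIntegral.integral_comp_sub_right]
  have := hg.intervalIntegral_add_eq (-s) 0
  simpa [sub_eq_neg_add] using this

/-- The squared `L²` distance between `Y` and its rotation by `s` about the polar axis. -/
def rotDistSq (Y : ℝ × ℝ × ℝ → ℝ) (s : ℝ) : ℝ :=
  ∫ φ in (0:ℝ)..(2*π), ∫ θ in (-(π/2))..(π/2),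
    (sphRep Y (φ - s) θ - sphRep Y φ θ) ^ 2 * Real.cos θ

lemma rotDistSq_pos {Y : ℝ × ℝ × ℝ → ℝ} (hY : Continuous Y) {s φ θ : ℝ}
    (hθ : θ ∈ Set.Ioo (-(π/2)) (π/2)) (h : sphRep Y (φ - s) θ ≠ sphRep Y φ θ) :
    0 < rotDistSq Y s := by
  have hc := continuous_sphRep hY
  have hF : Continuous fun p : ℝ × ℝ =>
      (sphRep Y (p.1 - s) p.2 - sphRep Y p.1 p.2) ^ 2 * Real.cos p.2 := by
    have := hc.comp (f := fun p : ℝ × ℝ => (p.1 - s, p.2)) (by fun_prop)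
    exact ((this.sub hc).pow 2).mul (by fun_prop)
  have hnn : ∀ φ, ∀ θ ∈ Set.Icc (-(π/2)) (π/2),
      0 ≤ (sphRep Y (φ - s) θ - sphRep Y φ θ) ^ 2 * Real.cos θ := fun φ θ hθ =>
    mul_nonneg (sq_nonneg _) (Real.cos_nonneg_of_mem_Icc hθ)
  have hpi := Real.pi_pos
  have hper : Function.Periodic (fun φ => ∫ θ in (-(π/2))..(π/2),
      (sphRep Y (φ - s) θ - sphRep Y φ θ) ^ 2 * Real.cos θ) (2 * π) := by
    intro φ
    simp only [add_sub_right_comm, sphRep_add_two_pi]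
  have hshift := hper.intervalIntegral_add_eq 0 φ
  rw [zero_add] at hshift
  rw [rotDistSq, hshift]
  refine intervalIntegral.integral_pos (by linarith)
    (continuous_integral_lat hF).continuousOn
    (fun x _ => intervalIntegral.integral_nonneg (by linarith) (hnn x))
    ⟨φ, ⟨le_rfl, by linarith⟩, ?_⟩
  refine intervalIntegral.integral_pos (by linarith)
    (hF.comp (by fun_prop : Continuous fun θ : ℝ => (φ, θ))).continuousOn
    (fun x hx => hnn φ x ⟨hx.1.le, hx.2⟩) ⟨θ, ⟨hθ.1.le, hθ.2.le⟩, ?_⟩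
  exact mul_pos (pow_pos (abs_pos.mpr (sub_ne_zero.mpr h)) 2 |>.trans_eq (sq_abs _))
    (Real.cos_pos_of_mem_Ioo hθ)

/-- A zonal function is orthogonal to the difference of two rotations of `Y`. -/
lemma integral_zonal_add_rotation_sub_sq {Y : ℝ × ℝ × ℝ → ℝ} (hY : Continuous Y)
    (e β a b : ℝ) :
    ∫ φ in (0:ℝ)..(2*π), ∫ θ in (-(π/2))..(π/2),
        (e * Real.sin θ + β * (sphRep Y (φ - a) θ - sphRep Y (φ - b) θ)) ^ 2 * Real.cos θ
      = e ^ 2 * (4 * π / 3) + β ^ 2 * rotDistSq Y (a - b) := by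
  have hc := continuous_sphRep hY
  have hca (a : ℝ) : Continuous fun p : ℝ × ℝ => sphRep Y (p.1 - a) p.2 :=
    hc.comp (f := fun p : ℝ × ℝ => (p.1 - a, p.2)) (by fun_prop)
  have hcθ (φ : ℝ) : Continuous fun θ => sphRep Y φ θ :=
    hc.comp (f := fun θ : ℝ => (φ, θ)) (by fun_prop)
  set G : ℝ → ℝ := fun φ => ∫ θ in (-(π/2))..(π/2),
    sphRep Y φ θ * (Real.sin θ * Real.cos θ) with hG
  set Q : ℝ → ℝ := fun φ => ∫ θ in (-(π/2))..(π/2),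
    (sphRep Y (φ - (a - b)) θ - sphRep Y φ θ) ^ 2 * Real.cos θ with hQ
  have hGc : Continuous G := continuous_integral_lat (by fun_prop)
  have hQc : Continuous Q := by
    have := hca (a - b)
    exact continuous_integral_lat (by fun_prop)
  have hGp : Function.Periodic G (2 * π) := fun φ => by
    simp only [hG, sphRep_add_two_pi]
  have hQp : Function.Periodic Q (2 * π) := fun φ => by
    simp only [hQ, add_sub_right_comm, sphRep_add_two_pi]
  have inner (φ : ℝ) : ∫ θ in (-(π/2))..(π/2),
      (e * Real.sin θ + β * (sphRep Y (φ - a) θ - sphRep Y (φ - b) θ)) ^ 2 * Real.cos θ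
      = e ^ 2 * (2 / 3) + 2 * e * β * (G (φ - a) - G (φ - b)) + β ^ 2 * Q (φ - b) := by
    have h₁ := hcθ (φ - a)
    have h₂ := hcθ (φ - b)
    simp only [hG, hQ, ← integral_sin_sq_mul_cos_pi_div_two,
      show φ - b - (a - b) = φ - a by ring]
    rw [← intervalIntegral.integral_sub, ← intervalIntegral.integral_const_mul,
      ← intervalIntegral.integral_const_mul, ← intervalIntegral.integral_const_mul,
      ← intervalIntegral.integral_add, ← intervalIntegral.integral_add]
    · congr 1
      ext θ
      ring
    all_goals exact Continuous.intervalIntegrable (by fun_prop) _ _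
  simp only [inner]
  rw [intervalIntegral.integral_add, intervalIntegral.integral_add,
    intervalIntegral.integral_const_mul, intervalIntegral.integral_const_mul,
    intervalIntegral.integral_const_mul, intervalIntegral.integral_sub, hGp.intervalIntegral_comp_sub,
    hGp.intervalIntegral_comp_sub, hQp.intervalIntegral_comp_sub]
  · simp only [intervalIntegral.integral_const, smul_eq_mul, rotDistSq, hQ]
    ring
  all_goals exact Continuous.intervalIntegrable (by fun_prop) _ _

lemma exists_rotDistSq_pos {Y : ℝ × ℝ × ℝ → ℝ} (hY : Continuous Y)
    (hnz : ∃ φ φ' θ : ℝ, sphRep Y φ θ ≠ sphRep Y φ' θ) :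
    ∃ s > 0, 0 < rotDistSq Y s := by
  obtain ⟨φ, φ', θ, hθ, hne⟩ := exists_lat_mem_Ioo_sphRep_ne hnz
  rcases lt_trichotomy φ φ' with hlt | rfl | hgt
  · exact ⟨φ' - φ, sub_pos.mpr hlt, rotDistSq_pos hY (φ := φ') hθ (by simpa using hne)⟩
  · exact absurd rfl hne
  · exact ⟨φ - φ', sub_pos.mpr hgt, rotDistSq_pos hY (φ := φ) hθ (by simpa using hne.symm)⟩

/-- Instability of non-zonal Rossby–Haurwitz waves: the travelling waves
`Ψ̂ⁿ(t,φ,θ) = (α+1/n) sin θ + β 𝒴(φ − ĉₙ t, θ)` start at `L²` distance `(1/n)·√(4π/3)` from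
`Ψ(t,φ,θ) = α sin θ + β 𝒴(φ − c t, θ)`, yet stay at distance `> ε` for some uniform `ε > 0`. -/
theorem rossby_haurwitz_unstable (ω α β : ℝ) (hβ : β ≠ 0) (j : ℕ) (hj : 2 ≤ j)
    (Y : ℝ × ℝ × ℝ → ℝ) (hY : ContDiff ℝ (⊤ : ℕ∞) Y)
    (hnz : ∃ φ φ' θ : ℝ, sphRep Y φ θ ≠ sphRep Y φ' θ)
    (heig : ∀ φ θ : ℝ, θ ∈ Set.Ioo (-(π/2)) (π/2) →
      LB (sphRep Y) φ θ = -((j : ℝ) * ((j : ℝ) + 1)) * sphRep Y φ θ) :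
    (∀ n : ℕ, 1 ≤ n →
      Real.sqrt (∫ φ in (0:ℝ)..(2*π), ∫ θ in (-(π/2))..(π/2),
          (((α + 1/(n : ℝ)) * Real.sin θ + β * sphRep Y φ θ)
            - (α * Real.sin θ + β * sphRep Y φ θ)) ^ 2 * Real.cos θ)
        = (1/(n : ℝ)) * Real.sqrt (4 * π / 3))
    ∧ ∃ ε > (0:ℝ), ∀ n : ℕ, 1 ≤ n → ∃ t > (0:ℝ),
        Real.sqrt (∫ φ in (0:ℝ)..(2*π), ∫ θ in (-(π/2))..(π/2),
          (((α + 1/(n : ℝ)) * Real.sin θ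
              + β * sphRep Y (φ - RHspeed ω (α + 1/(n : ℝ)) j * t) θ)
            - (α * Real.sin θ + β * sphRep Y (φ - RHspeed ω α j * t) θ)) ^ 2 * Real.cos θ)
          > ε := by
  have hYc : Continuous Y := hY.continuous
  constructor
  · intro n hn
    have h := integral_zonal_add_rotation_sub_sq hYc (1 / (n : ℝ)) 0 0 0
    simp only [zero_mul, add_zero, ne_eq, OfNat.ofNat_ne_zero, not_false_eq_true,
      zero_pow] at h
    simp only [add_sub_add_right_eq_sub, ← sub_mul, add_sub_cancel_left]
    rw [h, Real.sqrt_mul (sq_nonneg _), Real.sqrt_sq (by positivity)]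
  · obtain ⟨s, hs, hpos⟩ := exists_rotDistSq_pos hYc hnz
    have hβ2 : 0 < β ^ 2 := by positivity
    refine ⟨√(β ^ 2 * rotDistSq Y s), Real.sqrt_pos.mpr (mul_pos hβ2 hpos), fun n hn => ?_⟩
    have hn0 : (0:ℝ) < n := by exact_mod_cast hn
    have hj2 : (2:ℝ) ≤ j := by exact_mod_cast hj
    have hδ : 0 < RHspeed ω (α + 1/(n : ℝ)) j - RHspeed ω α j := by
      have : RHspeed ω (α + 1/(n : ℝ)) j - RHspeed ω α j
          = 1/(n : ℝ) * ((j : ℝ) * ((j : ℝ) + 1) - 2) / ((j : ℝ) * ((j : ℝ) + 1)) := by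
        unfold RHspeed
        ring
      rw [this]
      have : 0 < (j : ℝ) * ((j : ℝ) + 1) - 2 := by nlinarith
      positivity
    refine ⟨s / (RHspeed ω (α + 1/(n : ℝ)) j - RHspeed ω α j), div_pos hs hδ, ?_⟩
    set t := s / (RHspeed ω (α + 1/(n : ℝ)) j - RHspeed ω α j) with ht
    have hst : RHspeed ω (α + 1/(n : ℝ)) j * t - RHspeed ω α j * t = s := by
      rw [← sub_mul, ht, mul_div_cancel₀ _ hδ.ne']
    have h := integral_zonal_add_rotation_sub_sq hYc (1 / (n : ℝ)) β
      (RHspeed ω (α + 1/(n : ℝ)) j * t) (RHspeed ω α j * t)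
    rw [hst] at h
    have hrw (x y z : ℝ) : (α + 1/(n : ℝ)) * x + β * y - (α * x + β * z)
        = 1/(n : ℝ) * x + β * (y - z) := by ring
    simp only [hrw]
    rw [h]
    exact Real.sqrt_lt_sqrt (by positivity) (lt_add_of_pos_left _ (by positivity))
end
end
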